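/- Generalized trace-splitting of subtyping: let Λ = [l₁, …, lₙ] be a consistent permission trace (each permission occurs at most once), and for 1 ≤ i ≤ n let Λᵢ = [l₁, …, l_{i−1}, ¬lᵢ] be the trace whose first i−1 literals agree with Λ and whose i-th literal has the opposite sign (these traces form the disjunctive normal form of ¬Λ). Then for all base security types s, t: s ≤ t if and only if s·Λ ≤ t·Λ and s·Λᵢ ≤ t·Λᵢ for every i with 1 ≤ i ≤ n. -/

import Mathlib

/-- A signed permission (literal): `⊕p` or `⊖p`. -/
inductive SPerm (Perm : Type*) where
  | pos : Perm → SPerm Perm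
  | neg : Perm → SPerm Perm

/-- The underlying permission of a literal. -/
def SPerm.perm {Perm : Type*} : SPerm Perm → Perm
  | .pos p => p
  | .neg p => p

/-- Promotion of a base security type at permission `p`. -/
def promote {Perm : Type*} [DecidableEq Perm] {L : Type*} [Lattice L]
    (t : Finset Perm → L) (p : Perm) : Finset Perm → L :=
  fun P => t (P ∪ {p})

/-- Demotion of a base security type at permission `p`. -/
def demote {Perm : Type*} [DecidableEq Perm] {L : Type*} [Lattice L]
    (t : Finset Perm → L) (p : Perm) : Finset Perm → L :=
  fun P => t (P \ {p})

/-- Application of a permission trace (list of literals) to a base security type. -/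
def applyTrace {Perm : Type*} [DecidableEq Perm] {L : Type*} [Lattice L] :
    (Finset Perm → L) → List (SPerm Perm) → (Finset Perm → L)
  | t, [] => t
  | t, .pos p :: Λ => applyTrace (promote t p) Λ
  | t, .neg p :: Λ => applyTrace (demote t p) Λ

/-- Negation of a literal: `¬(⊕p) = ⊖p` and `¬(⊖p) = ⊕p`. -/
def SPerm.negate {Perm : Type*} : SPerm Perm → SPerm Perm
  | .pos p => .neg p
  | .neg p => .pos p

/-- Subtyping splits into subtyping after promotion and after demotion at a permission. -/
theorem le_iff_promote_le_and_demote_le {Perm : Type*} [DecidableEq Perm] {L : Type*} [Lattice L]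
    (p : Perm) (s t : Finset Perm → L) :
    s ≤ t ↔ promote s p ≤ promote t p ∧ demote s p ≤ demote t p := by
  refine ⟨fun h => ⟨fun P => h _, fun P => h _⟩, fun ⟨hpos, hneg⟩ P => ?_⟩
  by_cases hp : p ∈ P
  · have hP : P ∪ {p} = P := Finset.union_eq_left.mpr (Finset.singleton_subset_iff.mpr hp)
    simpa only [promote, hP] using hpos P
  · have hP : P \ {p} = P :=
      Finset.sdiff_eq_self_of_disjoint (Finset.disjoint_singleton_right.mpr hp)
    simpa only [demote, hP] using hneg P

/-- Applying a nonempty trace applies its first literal and then the rest. -/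
theorem applyTrace_cons {Perm : Type*} [DecidableEq Perm] {L : Type*} [Lattice L]
    (t : Finset Perm → L) (l : SPerm Perm) (Λ : List (SPerm Perm)) :
    applyTrace t (l :: Λ) = applyTrace (applyTrace t [l]) Λ := by
  cases l <;> rfl

/-- Subtyping splits into subtyping after a literal and after its negation. -/
theorem le_iff_applyTrace_singleton {Perm : Type*} [DecidableEq Perm] {L : Type*} [Lattice L]
    (l : SPerm Perm) (s t : Finset Perm → L) :
    s ≤ t ↔ applyTrace s [l] ≤ applyTrace t [l] ∧
      applyTrace s [l.negate] ≤ applyTrace t [l.negate] := by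
  cases l with
  | pos p => exact le_iff_promote_le_and_demote_le p s t
  | neg p => exact (le_iff_promote_le_and_demote_le p s t).trans and_comm

/-- Generalized trace-splitting of subtyping: for a consistent trace
`Λ = [l₁, …, lₙ]`, `s ≤ t` iff `s·Λ ≤ t·Λ` and `s·Λᵢ ≤ t·Λᵢ` for each `i`,
where `Λᵢ = [l₁, …, l_{i−1}, ¬lᵢ]`. -/
theorem le_iff_applyTrace_dnf {Perm : Type*} [DecidableEq Perm] {L : Type*} [Lattice L]
    (Λ : List (SPerm Perm)) (hconsistent : (Λ.map SPerm.perm).Nodup)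
    (s t : Finset Perm → L) :
    s ≤ t ↔
      (applyTrace s Λ ≤ applyTrace t Λ ∧
        ∀ i : Fin Λ.length,
          applyTrace s (Λ.take i ++ [(Λ.get i).negate]) ≤
            applyTrace t (Λ.take i ++ [(Λ.get i).negate])) := by
  induction Λ generalizing s t with
  | nil => simp [applyTrace]
  | cons l Λ ih =>
    have htail : (Λ.map SPerm.perm).Nodup := (List.nodup_cons.mp hconsistent).2
    rw [le_iff_applyTrace_singleton l s t, ih htail, applyTrace_cons s l Λ, applyTrace_cons t l Λ,
      and_assoc]
    refine and_congr_right fun _ => ?_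
    refine Iff.trans ?_ (Fin.forall_fin_succ (n := Λ.length)).symm
    rw [and_comm]
    refine and_congr Iff.rfl (forall_congr' fun i => ?_)
    simp only [Fin.val_succ, List.take_succ_cons, List.cons_append, List.get_cons_succ']
    rw [applyTrace_cons s l (_ ++ _), applyTrace_cons t l (_ ++ _)]
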